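/- (Weak completeness with iterative divisions.) If a sequent in the language with iterative divisions is true in every non-standard square R-model (extended with the interpretation v(A*\B) = (v(A))* \ v(B) and v(B/A*) = v(B) / (v(A))*, where * denotes reflexive–transitive closure of a relation), then it is derivable in the infinitary calculus L^Λ(∧,0,1,ItD). -/

import Mathlib

/-- Formulae of the Lambek calculus with intersection, constants 0 and 1, and
iterative divisions `A*\B` and `B/A*`. -/
inductive Fm where
  | var : ℕ → Fm                -- propositional variable
  | zero : Fm                   -- constant 0
  | one : Fm                    -- constant 1
  | mul : Fm → Fm → Fm          -- product A·B
  | ldiv : Fm → Fm → Fm         -- left division A\B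
  | rdiv : Fm → Fm → Fm         -- right division B/A
  | inter : Fm → Fm → Fm        -- intersection A∧B
  | starldiv : Fm → Fm → Fm     -- iterative left division A*\B
  | rdivstar : Fm → Fm → Fm     -- iterative right division B/A*

/-- Derivability of sequents in the infinitary calculus `L^Λ(∧,0,1,ItD)`. -/
inductive Deriv : List Fm → Fm → Prop
  | id (A) : Deriv [A] A
  | oneR : Deriv [] Fm.one
  | zeroL (Γ Δ C) : Deriv (Γ ++ [Fm.zero] ++ Δ) C
  | cut {P A Γ Δ C} : Deriv P A → Deriv (Γ ++ [A] ++ Δ) C →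
      Deriv (Γ ++ P ++ Δ) C
  | ldivL {P A Γ B Δ C} : Deriv P A → Deriv (Γ ++ [B] ++ Δ) C →
      Deriv (Γ ++ P ++ [Fm.ldiv A B] ++ Δ) C
  | ldivR {P A B} : Deriv (A :: P) B → Deriv P (Fm.ldiv A B)
  | rdivL {P A Γ B Δ C} : Deriv P A → Deriv (Γ ++ [B] ++ Δ) C →
      Deriv (Γ ++ [Fm.rdiv B A] ++ P ++ Δ) C
  | rdivR {P A B} : Deriv (P ++ [A]) B → Deriv P (Fm.rdiv B A)
  | mulL {Γ A B Δ C} : Deriv (Γ ++ [A, B] ++ Δ) C →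
      Deriv (Γ ++ [Fm.mul A B] ++ Δ) C
  | mulR {P A Δ B} : Deriv P A → Deriv Δ B → Deriv (P ++ Δ) (Fm.mul A B)
  | andL1 {Γ A B Δ C} : Deriv (Γ ++ [A] ++ Δ) C →
      Deriv (Γ ++ [Fm.inter A B] ++ Δ) C
  | andL2 {Γ A B Δ C} : Deriv (Γ ++ [B] ++ Δ) C →
      Deriv (Γ ++ [Fm.inter A B] ++ Δ) C
  | andR {P A B} : Deriv P A → Deriv P B → Deriv P (Fm.inter A B)
  | oneL {Γ Δ C} : Deriv (Γ ++ Δ) C → Deriv (Γ ++ [Fm.one] ++ Δ) C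
  -- *\L: from Π₁ → A, …, Πₙ → A and Γ, B, Δ → C infer Γ, Π₁, …, Πₙ, A*\B, Δ → C
  | starldivL {A Γ B Δ C} (Ps : List (List Fm)) :
      (∀ P ∈ Ps, Deriv P A) → Deriv (Γ ++ [B] ++ Δ) C →
      Deriv (Γ ++ Ps.flatten ++ [Fm.starldiv A B] ++ Δ) C
  -- ω-rule *\R: from Aⁿ, Π → B for all n ≥ 0 infer Π → A*\B
  | starldivR {P A B} : (∀ n : ℕ, Deriv (List.replicate n A ++ P) B) →
      Deriv P (Fm.starldiv A B)
  -- /*L: from Π₁ → A, …, Πₙ → A and Γ, B, Δ → C infer Γ, B/A*, Π₁, …, Πₙ, Δ → C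
  | rdivstarL {A Γ B Δ C} (Ps : List (List Fm)) :
      (∀ P ∈ Ps, Deriv P A) → Deriv (Γ ++ [B] ++ Δ) C →
      Deriv (Γ ++ [Fm.rdivstar B A] ++ Ps.flatten ++ Δ) C
  -- ω-rule /*R: from Π, Aⁿ → B for all n ≥ 0 infer Π → B/A*
  | rdivstarR {P A B} : (∀ n : ℕ, Deriv (P ++ List.replicate n A) B) →
      Deriv P (Fm.rdivstar B A)

/-- Relational composition of binary relations on `W`. -/
def rcomp {W : Type} (R S : Set (W × W)) : Set (W × W) :=
  {p | ∃ y, (p.1, y) ∈ R ∧ (y, p.2) ∈ S}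

/-- Left residual `R \ S`. -/
def lres {W : Type} (R S : Set (W × W)) : Set (W × W) :=
  {p | ∀ x, (x, p.1) ∈ R → (x, p.2) ∈ S}

/-- Right residual `S / R`. -/
def rres {W : Type} (S R : Set (W × W)) : Set (W × W) :=
  {p | ∀ z, (p.2, z) ∈ R → (p.1, z) ∈ S}

/-- The diagonal relation `δ`. -/
def diag {W : Type} : Set (W × W) := {p | p.1 = p.2}

/-- Reflexive–transitive closure of a binary relation on `W`. -/
def rstar {W : Type} (R : Set (W × W)) : Set (W × W) :=
  {p | Relation.ReflTransGen (fun a b => (a, b) ∈ R) p.1 p.2}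

/-- A non-standard square R-model, extended with the interpretation of the iterative
divisions via reflexive–transitive closure. -/
structure NSModel (W : Type) where
  famA : Set (Set (W × W))
  unit : Set (W × W)
  zero : Set (W × W)
  v : Fm → Set (W × W)
  closed_comp : ∀ R ∈ famA, ∀ S ∈ famA, rcomp R S ∈ famA
  closed_lres : ∀ R ∈ famA, ∀ S ∈ famA, lres R S ∈ famA
  closed_rres : ∀ S ∈ famA, ∀ R ∈ famA, rres S R ∈ famA
  closed_inter : ∀ R ∈ famA, ∀ S ∈ famA, R ∩ S ∈ famA
  unit_mem : unit ∈ famA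
  zero_mem : zero ∈ famA
  unit_comp : ∀ R ∈ famA, rcomp unit R = R
  comp_unit : ∀ R ∈ famA, rcomp R unit = R
  zero_least : ∀ R ∈ famA, zero ⊆ R
  v_mem : ∀ A, v A ∈ famA
  v_mul : ∀ A B, v (Fm.mul A B) = rcomp (v A) (v B)
  v_ldiv : ∀ A B, v (Fm.ldiv A B) = lres (v A) (v B)
  v_rdiv : ∀ B A, v (Fm.rdiv B A) = rres (v B) (v A)
  v_inter : ∀ A B, v (Fm.inter A B) = v A ∩ v B
  v_one : v Fm.one = unit
  v_zero : v Fm.zero = zero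
  v_starldiv : ∀ A B, v (Fm.starldiv A B) = lres (rstar (v A)) (v B)
  v_rdivstar : ∀ B A, v (Fm.rdivstar B A) = rres (v B) (rstar (v A))

/-- Interpretation of an antecedent: `v(A₁)∘…∘v(Aₙ)`, with `δ` for the empty list. -/
def NSModel.vList {W : Type} (M : NSModel W) : List Fm → Set (W × W)
  | [] => diag
  | A :: Γ => rcomp (M.v A) (M.vList Γ)

/-- Truth of a sequent in such a model. -/
def NSModel.seqTrue {W : Type} (M : NSModel W) (s : List Fm × Fm) : Prop :=
  M.vList s.1 ⊆ M.v s.2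

namespace Fm

/-- Derivability of `B` from the single antecedent `A`. -/
def Le (A B : Fm) : Prop := Deriv [A] B

/-- An injective numbering of formulae. -/
def code : Fm → ℕ
  | var n => Nat.pair 0 n
  | zero => Nat.pair 1 0
  | one => Nat.pair 2 0
  | mul A B => Nat.pair 3 (Nat.pair A.code B.code)
  | ldiv A B => Nat.pair 4 (Nat.pair A.code B.code)
  | rdiv A B => Nat.pair 5 (Nat.pair A.code B.code)
  | inter A B => Nat.pair 6 (Nat.pair A.code B.code)
  | starldiv A B => Nat.pair 7 (Nat.pair A.code B.code)
  | rdivstar A B => Nat.pair 8 (Nat.pair A.code B.code)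

theorem code_injective : Function.Injective code := by
  intro A
  induction A with
  | var n => intro B h; cases B <;> simp_all [code, Nat.pair_eq_pair]
  | zero => intro B h; cases B <;> simp_all [code, Nat.pair_eq_pair]
  | one => intro B h; cases B <;> simp_all [code, Nat.pair_eq_pair]
  | mul A₁ A₂ h₁ h₂ | ldiv A₁ A₂ h₁ h₂ | rdiv A₁ A₂ h₁ h₂ | inter A₁ A₂ h₁ h₂
  | starldiv A₁ A₂ h₁ h₂ | rdivstar A₁ A₂ h₁ h₂ =>
    intro B h
    cases B <;> simp only [code, Nat.pair_eq_pair] at h <;>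
      first
      | omega
      | exact congrArg₂ _ (h₁ h.2.1) (h₂ h.2.2)

instance : Countable Fm := code_injective.countable

/-- The right-nested product of `n + 1` copies of `A`. -/
def powSucc (A : Fm) : ℕ → Fm
  | 0 => A
  | n + 1 => mul A (powSucc A n)

/-- The right-nested product of a list of formulae, ending in the constant `1`. -/
def prod : List Fm → Fm
  | [] => one
  | A :: Γ => mul A (prod Γ)

/-- A Kleene-style slash predicate, used to show that theorems `A · B` split. -/
def Slash : Fm → Prop
  | var _ => False
  | zero => False
  | one => True
  | mul A B => A.Slash ∧ B.Slash
  | ldiv A B => Deriv [] (ldiv A B) ∧ (A.Slash → B.Slash)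
  | rdiv B A => Deriv [] (rdiv B A) ∧ (A.Slash → B.Slash)
  | inter A B => A.Slash ∧ B.Slash
  | starldiv A B => Deriv [] (starldiv A B) ∧ B.Slash
  | rdivstar B A => Deriv [] (rdivstar B A) ∧ B.Slash

theorem Slash.deriv {A : Fm} (h : A.Slash) : Deriv [] A := by
  induction A with
  | var | zero => exact h.elim
  | one => exact .oneR
  | mul A B hA hB => exact .mulR (hA h.1) (hB h.2)
  | inter A B hA hB => exact .andR (hA h.1) (hB h.2)
  | ldiv | rdiv | starldiv | rdivstar => exact h.1

end Fm

open Fm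

namespace Deriv

theorem of_forall_deriv {Γ : List Fm} {C : Fm} (h : Deriv Γ C)
    (hΓ : ∀ A ∈ Γ, Deriv [] A) : Deriv [] C := by
  induction Γ with
  | nil => exact h
  | cons A Γ ih =>
    refine ih ?_ fun B hB => hΓ B (List.mem_cons_of_mem _ hB)
    exact cut (Γ := []) (Δ := Γ) (hΓ A List.mem_cons_self) h

theorem slash {Γ : List Fm} {C : Fm} (h : Deriv Γ C) (hΓ : ∀ A ∈ Γ, A.Slash) : C.Slash := by
  have thm {Γ : List Fm} {C : Fm} (h : Deriv Γ C) (hΓ : ∀ A ∈ Γ, A.Slash) : Deriv [] C :=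
    h.of_forall_deriv fun A hA => (hΓ A hA).deriv
  induction h with
  | id A => exact hΓ A (by simp)
  | oneR => trivial
  | zeroL Γ Δ C => exact (hΓ zero (by simp)).elim
  | cut _ _ ih₁ ih₂ =>
    refine ih₂ ?_
    have := ih₁ fun A hA => hΓ A (by simp [hA])
    grind
  | @ldivL P A Γ B Δ C _ _ ih₁ ih₂ =>
    refine ih₂ ?_
    have := ih₁ fun A hA => hΓ A (by simp [hA])
    have := (hΓ (ldiv A B) (by simp)).2 this
    grind
  | @rdivL P A Γ B Δ C _ _ ih₁ ih₂ =>
    refine ih₂ ?_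
    have := ih₁ fun A hA => hΓ A (by simp [hA])
    have := (hΓ (rdiv B A) (by simp)).2 this
    grind
  | ldivR h ih => exact ⟨thm h.ldivR hΓ, fun hA => ih (by grind)⟩
  | rdivR h ih => exact ⟨thm h.rdivR hΓ, fun hA => ih (by grind)⟩
  | @mulL Γ A B Δ C _ ih =>
    have : A.Slash ∧ B.Slash := hΓ (mul A B) (by simp)
    exact ih (by grind)
  | mulR _ _ ih₁ ih₂ =>
    exact ⟨ih₁ fun A hA => hΓ A (by simp [hA]), ih₂ fun A hA => hΓ A (by simp [hA])⟩
  | @andL1 Γ A B Δ C _ ih | @andL2 Γ A B Δ C _ ih =>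
    have : A.Slash ∧ B.Slash := hΓ (inter A B) (by simp)
    exact ih (by grind)
  | andR _ _ ih₁ ih₂ => exact ⟨ih₁ hΓ, ih₂ hΓ⟩
  | oneL _ ih => exact ih (by grind)
  | @starldivL A Γ B Δ C Ps _ _ _ ih =>
    have : B.Slash := (hΓ (starldiv A B) (by simp)).2
    exact ih (by grind)
  | starldivR h ih => exact ⟨thm (starldivR h) hΓ, ih 0 (by simpa using hΓ)⟩
  | @rdivstarL A Γ B Δ C Ps _ _ _ ih =>
    have : B.Slash := (hΓ (rdivstar B A) (by simp)).2
    exact ih (by grind)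
  | rdivstarR h ih => exact ⟨thm (rdivstarR h) hΓ, ih 0 (by simpa using hΓ)⟩

theorem split_mul {A B : Fm} (h : Deriv [] (mul A B)) : Deriv [] A ∧ Deriv [] B :=
  have := h.slash (by simp)
  ⟨this.1.deriv, this.2.deriv⟩

theorem trans_le {Γ : List Fm} {A B : Fm} (h : Deriv Γ A) (h' : A.Le B) : Deriv Γ B := by
  simpa using cut (Γ := []) (Δ := []) h h'

theorem le_mul {A B C : Fm} (h : Deriv [A, B] C) : (mul A B).Le C :=
  mulL (Γ := []) (Δ := []) h

theorem one_le {A : Fm} (h : Deriv [] A) : one.Le A :=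
  oneL (Γ := []) (Δ := []) h

theorem prod_self (Γ : List Fm) : Deriv Γ (prod Γ) := by
  induction Γ with
  | nil => exact oneR
  | cons A Γ ih => exact mulR (.id A) ih

theorem replicate_powSucc (A : Fm) (n : ℕ) : Deriv (List.replicate (n + 1) A) (powSucc A n) := by
  induction n with
  | zero => exact .id A
  | succ n ih => exact mulR (.id A) ih

end Deriv

namespace Fm

theorem Le.refl (A : Fm) : A.Le A := .id A

theorem Le.trans {A B C : Fm} (h : A.Le B) (h' : B.Le C) : A.Le C := Deriv.trans_le h h'

theorem mul_le_mul {A A' B B' : Fm} (h : A.Le A') (h' : B.Le B') : (mul A B).Le (mul A' B') :=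
  Deriv.le_mul (.mulR h h')

theorem deriv_of_one_le {A : Fm} (h : one.Le A) : Deriv [] A := Deriv.oneR.trans_le h

theorem mul_assoc_le (A B C : Fm) : (mul (mul A B) C).Le (mul A (mul B C)) :=
  Deriv.mulL (Γ := []) (Δ := []) <| Deriv.mulL (Γ := []) (Δ := [C]) <|
    .mulR (P := [A]) (.id A) (.mulR (.id B) (.id C))

theorem le_mul_assoc (A B C : Fm) : (mul A (mul B C)).Le (mul (mul A B) C) :=
  Deriv.mulL (Γ := []) (Δ := []) <| Deriv.mulL (Γ := [A]) (Δ := []) <|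
    .mulR (P := [A, B]) (.mulR (.id A) (.id B)) (.id C)

theorem one_mul_le (A : Fm) : (mul one A).Le A :=
  Deriv.le_mul (Deriv.oneL (Γ := []) (Δ := [A]) (.id A))

theorem mul_one_le (A : Fm) : (mul A one).Le A :=
  Deriv.le_mul (Deriv.oneL (Γ := [A]) (Δ := []) (.id A))

theorem le_one_mul (A : Fm) : A.Le (mul one A) := .mulR (P := []) .oneR (.id A)

theorem le_mul_one (A : Fm) : A.Le (mul A one) := .mulR (P := [A]) (.id A) .oneR

theorem le_ldiv {A B C : Fm} : C.Le (ldiv A B) ↔ (mul A C).Le B := by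
  constructor
  · intro h
    exact (mul_le_mul (.refl A) h).trans <| Deriv.le_mul <|
      Deriv.ldivL (P := [A]) (Γ := []) (Δ := []) (.id A) (.id B)
  · intro h
    exact .ldivR (Deriv.trans_le (Deriv.mulR (P := [A]) (.id A) (.id C)) h)

theorem le_rdiv {A B C : Fm} : C.Le (rdiv B A) ↔ (mul C A).Le B := by
  constructor
  · intro h
    exact (mul_le_mul h (.refl A)).trans <| Deriv.le_mul <|
      Deriv.rdivL (P := [A]) (Γ := []) (Δ := []) (.id A) (.id B)
  · intro h
    exact .rdivR (Deriv.trans_le (Deriv.mulR (P := [C]) (.id C) (.id A)) h)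

theorem le_inter {A B C : Fm} : C.Le (inter A B) ↔ C.Le A ∧ C.Le B :=
  ⟨fun h => ⟨h.trans (Deriv.andL1 (Γ := []) (Δ := []) (.id A)),
    h.trans (Deriv.andL2 (Γ := []) (Δ := []) (.id B))⟩, fun h => .andR h.1 h.2⟩

theorem zero_le (A : Fm) : zero.Le A := .zeroL [] [] A

theorem starldiv_le (A B : Fm) : (starldiv A B).Le B :=
  Deriv.starldivL (Γ := []) (Δ := []) [] (by simp) (.id B)

theorem rdivstar_le (A B : Fm) : (rdivstar B A).Le B :=
  Deriv.rdivstarL (Γ := []) (Δ := []) [] (by simp) (.id B)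

theorem mul_starldiv_le (A B : Fm) : (mul A (starldiv A B)).Le (starldiv A B) := by
  refine Deriv.le_mul (.starldivR fun n => ?_)
  have := Deriv.starldivL (A := A) (B := B) (C := B) (Γ := []) (Δ := [])
    (List.replicate (n + 1) [A]) (fun P hP => by
      rw [List.eq_of_mem_replicate hP]; exact .id A) (.id B)
  simpa [List.replicate_succ'] using this

theorem rdivstar_mul_le (A B : Fm) : (mul (rdivstar B A) A).Le (rdivstar B A) := by
  refine Deriv.le_mul (.rdivstarR fun n => ?_)
  have := Deriv.rdivstarL (A := A) (B := B) (C := B) (Γ := []) (Δ := [])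
    (List.replicate (n + 1) [A]) (fun P hP => by
      rw [List.eq_of_mem_replicate hP]; exact .id A) (.id B)
  simpa [List.replicate_succ] using this

theorem le_starldiv {A B C : Fm} (h₀ : C.Le B) (h : ∀ n, (mul (powSucc A n) C).Le B) :
    C.Le (starldiv A B) := by
  refine .starldivR fun n => ?_
  cases n with
  | zero => exact h₀
  | succ n => exact (Deriv.mulR (Deriv.replicate_powSucc A n) (.id C)).trans_le (h n)

theorem le_rdivstar {A B C : Fm} (h₀ : C.Le B) (h : ∀ n, (mul C (powSucc A n)).Le B) :
    C.Le (rdivstar B A) := by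
  refine .rdivstarR fun n => ?_
  cases n with
  | zero => exact h₀
  | succ n => exact (Deriv.mulR (.id C) (Deriv.replicate_powSucc A n)).trans_le (h n)

end Fm

/-- A labelling of pairs of natural numbers by at most one formula each that is reflexive,
transitive and antisymmetric; `ℓ x y = some C` means that exactly the consequences of `C`
hold at `(x, y)`. -/
structure Labelling (ℓ : ℕ → ℕ → Option Fm) : Prop where
  refl : ∀ x, ℓ x x = some one
  trans : ∀ {x y z C D}, ℓ x y = some C → ℓ y z = some D →
    ∃ E, ℓ x z = some E ∧ E.Le (mul C D)
  antisymm : ∀ {x y C D}, ℓ x y = some C → ℓ y x = some D → x = y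

/-- Relabel the pairs involving the point `N` by `p` (incoming) and `q` (outgoing). -/
def extendAt (ℓ : ℕ → ℕ → Option Fm) (N : ℕ) (p q : ℕ → Option Fm) (i j : ℕ) : Option Fm :=
  if i = N then if j = N then some one else q j
  else if j = N then p i else ℓ i j

theorem Labelling.extendAt {ℓ : ℕ → ℕ → Option Fm} (h : Labelling ℓ) {N : ℕ}
    {p q : ℕ → Option Fm}
    (hp : ∀ {u v C D}, ℓ u v = some C → p v = some D → ∃ E, p u = some E ∧ E.Le (mul C D))
    (hq : ∀ {u v C D}, q u = some C → ℓ u v = some D → ∃ E, q v = some E ∧ E.Le (mul C D))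
    (hpq : ∀ {u v C D}, p u = some C → q v = some D → ∃ E, ℓ u v = some E ∧ E.Le (mul C D))
    (hne : ∀ {u C D}, p u = some C → q u = some D → False) :
    Labelling (extendAt ℓ N p q) where
  refl x := by
    by_cases hx : x = N <;> simp [_root_.extendAt, hx, h.refl]
  trans {x y z C D} h₁ h₂ := by
    by_cases hx : x = N <;> by_cases hy : y = N <;> by_cases hz : z = N <;>
      simp only [_root_.extendAt, hx, hy, hz, if_true, if_false, Option.some.injEq] at h₁ h₂ ⊢
    · subst h₁ h₂; exact ⟨_, rfl, le_one_mul _⟩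
    · subst h₁; exact ⟨_, h₂, le_one_mul _⟩
    · exact (hne h₂ h₁).elim
    · exact hq h₁ h₂
    · subst h₂; exact ⟨_, h₁, le_mul_one _⟩
    · exact hpq h₁ h₂
    · exact hp h₁ h₂
    · exact h.trans h₁ h₂
  antisymm {x y C D} h₁ h₂ := by
    by_cases hx : x = N <;> by_cases hy : y = N <;>
      simp only [_root_.extendAt, hx, hy, if_true, if_false] at h₁ h₂ ⊢
    · exact (hne h₂ h₁).elim
    · exact (hne h₁ h₂).elim
    · exact h.antisymm h₁ h₂

/-- A request for a new point: an optional incoming edge from a given point with a given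
label, and an optional outgoing edge to a given point with a given label. -/
abbrev Request := Option (ℕ × Fm) × Option (ℕ × Fm)

/-- Labels of the edges into the new point. -/
def inLabel (ℓ : ℕ → ℕ → Option Fm) (r : Request) (u : ℕ) : Option Fm :=
  r.1.bind fun a => (ℓ u a.1).map fun C => mul C a.2

/-- Labels of the edges out of the new point. -/
def outLabel (ℓ : ℕ → ℕ → Option Fm) (r : Request) (u : ℕ) : Option Fm :=
  r.2.bind fun b => (ℓ b.1 u).map fun C => mul b.2 C

/-- A request can be served at stage `N`. -/
structure Request.Valid (ℓ : ℕ → ℕ → Option Fm) (N : ℕ) (r : Request) : Prop where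
  lt_fst : ∀ a ∈ r.1, a.1 < N
  lt_snd : ∀ b ∈ r.2, b.1 < N
  between : ∀ a ∈ r.1, ∀ b ∈ r.2, a.1 ≠ b.1 ∧ ∃ C, ℓ a.1 b.1 = some C ∧ C.Le (mul a.2 b.2)

theorem Labelling.serve {ℓ : ℕ → ℕ → Option Fm} (h : Labelling ℓ) {N : ℕ} {r : Request}
    (hr : r.Valid ℓ N) : Labelling (_root_.extendAt ℓ N (inLabel ℓ r) (outLabel ℓ r)) := by
  obtain ⟨a, b⟩ := r
  refine h.extendAt ?_ ?_ ?_ ?_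
  · intro u v C D h₁ h₂
    simp only [inLabel, Option.bind_eq_some_iff, Option.map_eq_some_iff] at h₂ ⊢
    obtain ⟨a, rfl, D, hD, rfl⟩ := h₂
    obtain ⟨E, hE, hle⟩ := h.trans h₁ hD
    exact ⟨_, ⟨a, rfl, E, hE, rfl⟩, (mul_le_mul hle (.refl _)).trans (mul_assoc_le _ _ _)⟩
  · intro u v C D h₁ h₂
    simp only [outLabel, Option.bind_eq_some_iff, Option.map_eq_some_iff] at h₁ ⊢
    obtain ⟨b, rfl, C, hC, rfl⟩ := h₁
    obtain ⟨E, hE, hle⟩ := h.trans hC h₂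
    exact ⟨_, ⟨b, rfl, E, hE, rfl⟩, (mul_le_mul (.refl _) hle).trans (le_mul_assoc _ _ _)⟩
  · intro u v C D h₁ h₂
    simp only [inLabel, outLabel, Option.bind_eq_some_iff, Option.map_eq_some_iff] at h₁ h₂
    obtain ⟨a, rfl, C, hC, rfl⟩ := h₁
    obtain ⟨b, rfl, D, hD, rfl⟩ := h₂
    obtain ⟨-, F, hF, hle⟩ := hr.between a rfl b rfl
    obtain ⟨G, hG, hG'⟩ := h.trans hC hF
    obtain ⟨E, hE, hE'⟩ := h.trans hG hD
    refine ⟨E, hE, hE'.trans ?_⟩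
    refine (mul_le_mul (hG'.trans (mul_le_mul (.refl _) hle)) (.refl _)).trans ?_
    exact (mul_le_mul (le_mul_assoc _ _ _) (.refl _)).trans (mul_assoc_le _ _ _)
  · intro u C D h₁ h₂
    simp only [inLabel, outLabel, Option.bind_eq_some_iff, Option.map_eq_some_iff] at h₁ h₂
    obtain ⟨a, rfl, C, hC, rfl⟩ := h₁
    obtain ⟨b, rfl, D, hD, rfl⟩ := h₂
    obtain ⟨hne, F, hF, -⟩ := hr.between a rfl b rfl
    obtain ⟨E, hE, -⟩ := h.trans hD hC
    exact hne (h.antisymm hF hE)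

open Classical in
/-- The labelling after `n` requests of the sequence `e` have been considered; the request
`e n`, if valid, is served by the point `n`. -/
noncomputable def stage (e : ℕ → Request) : ℕ → ℕ → ℕ → Option Fm
  | 0 => fun i j => if i = j then some one else none
  | n + 1 =>
    if (e n).Valid (stage e n) n then
      extendAt (stage e n) n (inLabel (stage e n) (e n)) (outLabel (stage e n) (e n))
    else stage e n

theorem stage_succ_of_valid {e : ℕ → Request} {n : ℕ} (h : (e n).Valid (stage e n) n) :
    stage e (n + 1) =
      extendAt (stage e n) n (inLabel (stage e n) (e n)) (outLabel (stage e n) (e n)) := by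
  simp [stage, h]

theorem labelling_stage (e : ℕ → Request) (n : ℕ) : Labelling (stage e n) := by
  induction n with
  | zero =>
    refine ⟨by simp [stage], ?_, ?_⟩
    · intro x y z C D h₁ h₂
      simp only [stage, Option.ite_none_right_eq_some, Option.some.injEq] at h₁ h₂ ⊢
      obtain ⟨rfl, rfl⟩ := h₁
      obtain ⟨rfl, rfl⟩ := h₂
      exact ⟨_, ⟨rfl, rfl⟩, le_one_mul _⟩
    · intro x y C D h₁ h₂
      simp only [stage, Option.ite_none_right_eq_some] at h₁
      exact h₁.1
  | succ n ih =>
    by_cases hr : (e n).Valid (stage e n) n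
    · rw [stage_succ_of_valid hr]; exact ih.serve hr
    · simpa [stage, hr] using ih

theorem stage_succ_of_lt (e : ℕ → Request) {n i j : ℕ} (hi : i < n) (hj : j < n) :
    stage e (n + 1) i j = stage e n i j := by
  by_cases hr : (e n).Valid (stage e n) n
  · rw [stage_succ_of_valid hr, extendAt, if_neg hi.ne, if_neg hj.ne]
  · simp [stage, hr]

theorem stage_eq_of_le (e : ℕ → Request) {m n i j : ℕ} (hi : i < m) (hj : j < m) (h : m ≤ n) :
    stage e n i j = stage e m i j := by
  induction n, h using Nat.le_induction with
  | base => rfl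
  | succ n hn ih => rw [stage_succ_of_lt e (by omega) (by omega), ih]

/-- The limit of the labellings `stage e n`. -/
noncomputable def limitLabel (e : ℕ → Request) (i j : ℕ) : Option Fm :=
  stage e (max i j + 1) i j

theorem limitLabel_eq (e : ℕ → Request) {n i j : ℕ} (hi : i < n) (hj : j < n) :
    limitLabel e i j = stage e n i j :=
  (stage_eq_of_le e (by omega) (by omega) (by omega)).symm

theorem labelling_limitLabel (e : ℕ → Request) : Labelling (limitLabel e) where
  refl x := (labelling_stage e _).refl x
  trans {x y z C D} h₁ h₂ := by
    have hx : x < x + y + z + 1 := by omega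
    have hy : y < x + y + z + 1 := by omega
    have hz : z < x + y + z + 1 := by omega
    rw [limitLabel_eq e hx hy] at h₁
    rw [limitLabel_eq e hy hz] at h₂
    rw [limitLabel_eq e hx hz]
    exact (labelling_stage e _).trans h₁ h₂
  antisymm {x y C D} h₁ h₂ := by
    have hx : x < x + y + 1 := by omega
    have hy : y < x + y + 1 := by omega
    rw [limitLabel_eq e hx hy] at h₁
    rw [limitLabel_eq e hy hx] at h₂
    exact (labelling_stage e _).antisymm h₁ h₂

/-- The formula `A` holds at the pair `(x, y)`. -/
def Holds (ℓ : ℕ → ℕ → Option Fm) (x y : ℕ) (A : Fm) : Prop :=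
  ∃ C, ℓ x y = some C ∧ C.Le A

/-- A labelling with all the witnesses needed for the truth lemma. -/
structure Saturated (ℓ : ℕ → ℕ → Option Fm) : Prop extends Labelling ℓ where
  split : ∀ {x z A B}, Holds ℓ x z (mul A B) → ∃ y, Holds ℓ x y A ∧ Holds ℓ y z B
  source : ∀ y z A, ∃ x, Holds ℓ x y A ∧ ℓ x z = (ℓ y z).map (mul A)
  target : ∀ x y A, ∃ z, Holds ℓ y z A ∧ ℓ x z = (ℓ x y).map fun C => mul C A

theorem limitLabel_new {e : ℕ → Request} {n x : ℕ} (hr : (e n).Valid (stage e n) n)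
    (hx : x < n) :
    limitLabel e x n = inLabel (limitLabel e) (e n) x ∧
      limitLabel e n x = outLabel (limitLabel e) (e n) x := by
  rw [limitLabel_eq e (n := n + 1) (by omega) (by omega),
    limitLabel_eq e (n := n + 1) (by omega) (by omega), stage_succ_of_valid hr]
  simp only [extendAt, if_neg hx.ne, if_true, inLabel, outLabel]
  constructor
  · cases h : (e n).1 with
    | none => rfl
    | some a => simp [limitLabel_eq e hx (hr.lt_fst a h)]
  · cases h : (e n).2 with
    | none => rfl
    | some a => simp [limitLabel_eq e (hr.lt_snd a h) hx]

theorem saturated_limitLabel {e : ℕ → Request} (he : ∀ r m, ∃ n, m ≤ n ∧ e n = r) :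
    Saturated (limitLabel e) := by
  have hL := labelling_limitLabel e
  refine { hL with split := ?_, source := ?_, target := ?_ }
  · rintro x z A B ⟨C, hC, hle⟩
    by_cases hxz : x = z
    · subst hxz
      rw [hL.refl, Option.some.injEq] at hC
      subst hC
      obtain ⟨hA, hB⟩ := (deriv_of_one_le hle).split_mul
      exact ⟨x, ⟨one, hL.refl x, hA.one_le⟩, ⟨one, hL.refl x, hB.one_le⟩⟩
    · obtain ⟨n, hn, hr⟩ := he (some (x, A), some (z, B)) (x + z + 1)
      have hx : x < n := by omega
      have hz : z < n := by omega
      have hv : (e n).Valid (stage e n) n := by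
        rw [hr]
        refine ⟨by simpa using hx, by simpa using hz, ?_⟩
        rintro _ ⟨⟩ _ ⟨⟩
        exact ⟨hxz, C, by rw [← limitLabel_eq e hx hz, hC], hle⟩
      refine ⟨n, ⟨mul one A, ?_, one_mul_le A⟩, ⟨mul B one, ?_, mul_one_le B⟩⟩
      · rw [(limitLabel_new hv hx).1]; simp [hr, inLabel, hL.refl]
      · rw [(limitLabel_new hv hz).2]; simp [hr, outLabel, hL.refl]
  · intro y z A
    obtain ⟨n, hn, hr⟩ := he (none, some (y, A)) (y + z + 1)
    have hy : y < n := by omega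
    have hz : z < n := by omega
    have hv : (e n).Valid (stage e n) n := by
      rw [hr]; exact ⟨by simp, by simpa using hy, by simp⟩
    refine ⟨n, ⟨mul A one, ?_, mul_one_le A⟩, ?_⟩
    · rw [(limitLabel_new hv hy).2]; simp [hr, outLabel, hL.refl]
    · rw [(limitLabel_new hv hz).2]; simp [hr, outLabel]
  · intro x y A
    obtain ⟨n, hn, hr⟩ := he (some (y, A), none) (x + y + 1)
    have hx : x < n := by omega
    have hy : y < n := by omega
    have hv : (e n).Valid (stage e n) n := by
      rw [hr]; exact ⟨by simpa using hy, by simp, by simp⟩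
    refine ⟨n, ⟨mul one A, ?_, one_mul_le A⟩, ?_⟩
    · rw [(limitLabel_new hv hy).1]; simp [hr, inLabel, hL.refl]
    · rw [(limitLabel_new hv hx).1]; simp [hr, inLabel]

theorem exists_saturated : ∃ ℓ, Saturated ℓ := by
  obtain ⟨f, hf⟩ := exists_surjective_nat Request
  refine ⟨_, saturated_limitLabel (e := fun n => f n.unpair.1) fun r m => ?_⟩
  obtain ⟨k, rfl⟩ := hf r
  exact ⟨Nat.pair k m, Nat.right_le_pair k m, by simp⟩

theorem Holds.mono {ℓ : ℕ → ℕ → Option Fm} {x y : ℕ} {A B : Fm} (h : Holds ℓ x y A)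
    (hle : A.Le B) : Holds ℓ x y B :=
  let ⟨C, hC, hCA⟩ := h
  ⟨C, hC, hCA.trans hle⟩

theorem Labelling.holds_mul {ℓ : ℕ → ℕ → Option Fm} (h : Labelling ℓ) {x y z : ℕ} {A B : Fm}
    (hA : Holds ℓ x y A) (hB : Holds ℓ y z B) : Holds ℓ x z (mul A B) := by
  obtain ⟨C, hC, hCA⟩ := hA
  obtain ⟨D, hD, hDB⟩ := hB
  obtain ⟨E, hE, hle⟩ := h.trans hC hD
  exact ⟨E, hE, hle.trans (mul_le_mul hCA hDB)⟩

namespace Saturated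

variable {ℓ : ℕ → ℕ → Option Fm}

theorem holds_mul_iff (h : Saturated ℓ) {x z : ℕ} {A B : Fm} :
    Holds ℓ x z (mul A B) ↔ ∃ y, Holds ℓ x y A ∧ Holds ℓ y z B :=
  ⟨h.split, fun ⟨_, hA, hB⟩ => h.holds_mul hA hB⟩

theorem holds_ldiv_iff (h : Saturated ℓ) {y z : ℕ} {A B : Fm} :
    Holds ℓ y z (ldiv A B) ↔ ∀ x, Holds ℓ x y A → Holds ℓ x z B := by
  constructor
  · exact fun hAB x hA => (h.holds_mul hA hAB).mono (le_ldiv.1 (.refl _))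
  · intro hyp
    obtain ⟨x, hx, hxz⟩ := h.source y z A
    obtain ⟨C, hC, hle⟩ := hyp x hx
    rw [hxz, Option.map_eq_some_iff] at hC
    obtain ⟨D, hD, rfl⟩ := hC
    exact ⟨D, hD, le_ldiv.2 hle⟩

theorem holds_rdiv_iff (h : Saturated ℓ) {x y : ℕ} {A B : Fm} :
    Holds ℓ x y (rdiv B A) ↔ ∀ z, Holds ℓ y z A → Holds ℓ x z B := by
  constructor
  · exact fun hAB z hA => (h.holds_mul hAB hA).mono (le_rdiv.1 (.refl _))
  · intro hyp
    obtain ⟨z, hz, hxz⟩ := h.target x y A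
    obtain ⟨C, hC, hle⟩ := hyp z hz
    rw [hxz, Option.map_eq_some_iff] at hC
    obtain ⟨D, hD, rfl⟩ := hC
    exact ⟨D, hD, le_rdiv.2 hle⟩

theorem reflTransGen_of_holds_powSucc (h : Saturated ℓ) {A : Fm} {n : ℕ} {x y : ℕ}
    (hxy : Holds ℓ x y (powSucc A n)) : Relation.ReflTransGen (Holds ℓ · · A) x y := by
  induction n generalizing x with
  | zero => exact .single hxy
  | succ n ih =>
    obtain ⟨u, hxu, huy⟩ := h.split hxy
    exact .head hxu (ih huy)

theorem holds_starldiv_iff (h : Saturated ℓ) {y z : ℕ} {A B : Fm} :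
    Holds ℓ y z (starldiv A B) ↔
      ∀ x, Relation.ReflTransGen (Holds ℓ · · A) x y → Holds ℓ x z B := by
  constructor
  · intro hyz x hxy
    refine Holds.mono ?_ (starldiv_le A B)
    induction hxy using Relation.ReflTransGen.head_induction_on with
    | refl => exact hyz
    | head hA _ ih => exact (h.holds_mul hA ih).mono (mul_starldiv_le A B)
  · intro hyp
    obtain ⟨C, hC, hCB⟩ := hyp y .refl
    refine ⟨C, hC, le_starldiv hCB fun n => ?_⟩
    have : Holds ℓ y z (ldiv (powSucc A n) B) :=
      h.holds_ldiv_iff.2 fun x hx => hyp x (h.reflTransGen_of_holds_powSucc hx)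
    obtain ⟨D, hD, hle⟩ := this
    obtain rfl : C = D := Option.some.inj (hC.symm.trans hD)
    exact le_ldiv.1 hle

theorem holds_rdivstar_iff (h : Saturated ℓ) {x y : ℕ} {A B : Fm} :
    Holds ℓ x y (rdivstar B A) ↔
      ∀ z, Relation.ReflTransGen (Holds ℓ · · A) y z → Holds ℓ x z B := by
  constructor
  · intro hxy z hyz
    refine Holds.mono ?_ (rdivstar_le A B)
    induction hyz with
    | refl => exact hxy
    | tail _ hA ih => exact (h.holds_mul ih hA).mono (rdivstar_mul_le A B)
  · intro hyp
    obtain ⟨C, hC, hCB⟩ := hyp y .refl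
    refine ⟨C, hC, le_rdivstar hCB fun n => ?_⟩
    have : Holds ℓ x y (rdiv B (powSucc A n)) :=
      h.holds_rdiv_iff.2 fun z hz => hyp z (h.reflTransGen_of_holds_powSucc hz)
    obtain ⟨D, hD, hle⟩ := this
    obtain rfl : C = D := Option.some.inj (hC.symm.trans hD)
    exact le_rdiv.1 hle

theorem holds_inter_iff {x y : ℕ} {A B : Fm} :
    Holds ℓ x y (inter A B) ↔ Holds ℓ x y A ∧ Holds ℓ x y B := by
  constructor
  · exact fun h => ⟨h.mono (le_inter.1 (.refl _)).1, h.mono (le_inter.1 (.refl _)).2⟩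
  · rintro ⟨⟨C, hC, hA⟩, D, hD, hB⟩
    obtain rfl : C = D := Option.some.inj (hC.symm.trans hD)
    exact ⟨C, hC, le_inter.2 ⟨hA, hB⟩⟩

/-- The relation interpreting a formula. -/
def rel (ℓ : ℕ → ℕ → Option Fm) (A : Fm) : Set (ℕ × ℕ) := {p | Holds ℓ p.1 p.2 A}

theorem rel_mul (h : Saturated ℓ) (A B : Fm) : rel ℓ (mul A B) = rcomp (rel ℓ A) (rel ℓ B) :=
  Set.ext fun _ => h.holds_mul_iff

theorem rel_ldiv (h : Saturated ℓ) (A B : Fm) : rel ℓ (ldiv A B) = lres (rel ℓ A) (rel ℓ B) :=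
  Set.ext fun _ => h.holds_ldiv_iff

theorem rel_rdiv (h : Saturated ℓ) (B A : Fm) : rel ℓ (rdiv B A) = rres (rel ℓ B) (rel ℓ A) :=
  Set.ext fun _ => h.holds_rdiv_iff

theorem rel_inter (A B : Fm) : rel ℓ (inter A B) = rel ℓ A ∩ rel ℓ B :=
  Set.ext fun _ => holds_inter_iff

theorem rel_mono {A B : Fm} (hle : A.Le B) : rel ℓ A ⊆ rel ℓ B := fun _ hA => Holds.mono hA hle

/-- The non-standard square R-model of a saturated labelling. -/
def model (h : Saturated ℓ) : NSModel ℕ where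
  famA := Set.range (rel ℓ)
  unit := rel ℓ one
  zero := rel ℓ zero
  v := rel ℓ
  closed_comp := by rintro _ ⟨A, rfl⟩ _ ⟨B, rfl⟩; exact ⟨_, h.rel_mul A B⟩
  closed_lres := by rintro _ ⟨A, rfl⟩ _ ⟨B, rfl⟩; exact ⟨_, h.rel_ldiv A B⟩
  closed_rres := by rintro _ ⟨A, rfl⟩ _ ⟨B, rfl⟩; exact ⟨_, h.rel_rdiv A B⟩
  closed_inter := by rintro _ ⟨A, rfl⟩ _ ⟨B, rfl⟩; exact ⟨_, rel_inter A B⟩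
  unit_mem := ⟨_, rfl⟩
  zero_mem := ⟨_, rfl⟩
  unit_comp := by
    rintro _ ⟨A, rfl⟩
    rw [← h.rel_mul]
    exact (rel_mono (one_mul_le A)).antisymm (rel_mono (le_one_mul A))
  comp_unit := by
    rintro _ ⟨A, rfl⟩
    rw [← h.rel_mul]
    exact (rel_mono (mul_one_le A)).antisymm (rel_mono (le_mul_one A))
  zero_least := by rintro _ ⟨A, rfl⟩; exact rel_mono (zero_le A)
  v_mem A := ⟨A, rfl⟩
  v_mul := h.rel_mul
  v_ldiv := h.rel_ldiv
  v_rdiv := h.rel_rdiv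
  v_inter := rel_inter
  v_one := rfl
  v_zero := rfl
  v_starldiv _ _ := Set.ext fun _ => h.holds_starldiv_iff
  v_rdivstar _ _ := Set.ext fun _ => h.holds_rdivstar_iff

theorem holds_diag_iff (h : Saturated ℓ) {x : ℕ} {A : Fm} : Holds ℓ x x A ↔ Deriv [] A := by
  simp only [Holds, h.refl, Option.some.injEq, exists_eq_left']
  exact ⟨deriv_of_one_le, Deriv.one_le⟩

end Saturated

theorem NSModel.vList_cons_eq {W : Type} (M : NSModel W) (A : Fm) (Γ : List Fm) :
    M.vList (A :: Γ) = M.v (prod (A :: Γ)) := by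
  induction Γ generalizing A with
  | nil =>
    rw [prod, M.v_mul, prod, M.v_one, M.comp_unit _ (M.v_mem A)]
    ext ⟨x, y⟩
    simp [NSModel.vList, rcomp, diag]
  | cons B Γ ih => rw [NSModel.vList, ih, ← M.v_mul]; rfl

/-- Weak completeness with iterative divisions: if a sequent in the language with
iterative divisions is true in every non-standard square R-model, then it is
derivable in the infinitary calculus `L^Λ(∧,0,1,ItD)`. -/
theorem weak_completeness_iterative (P : List Fm) (B : Fm)
    (h : ∀ (W : Type) [Nonempty W] (M : NSModel W), M.seqTrue (P, B)) :
    Deriv P B := by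
  obtain ⟨ℓ, hℓ⟩ := exists_saturated
  have hM := h ℕ hℓ.model
  cases P with
  | nil => exact hℓ.holds_diag_iff.1 (hM (show ((0 : ℕ), (0 : ℕ)) ∈ diag from rfl))
  | cons A Γ =>
    rw [NSModel.seqTrue, NSModel.vList_cons_eq] at hM
    have : Deriv [] (ldiv (prod (A :: Γ)) B) :=
      (hℓ.holds_diag_iff (x := 0)).1 (hℓ.holds_ldiv_iff.2 fun x hx => @hM (x, 0) hx)
    have hle : (prod (A :: Γ)).Le B := (le_mul_one _).trans (le_ldiv.1 this.one_le)
    exact (Deriv.prod_self _).trans_le hle
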